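/- Let K be a field of characteristic 0 and W a K-vector space of dimension N+1. For integers a, b, ℓ with b ≤ a and a ≤ ℓ, the comultiplication map Φ : ⋀^a K^ℓ → ⋀^b K^ℓ ⊗ ⋀^{a−b} K^ℓ, defined by v_1 ∧ ⋯ ∧ v_a ↦ Σ sgn(I,I') v_I ⊗ v_{I'} where the sum is over subsets I ⊆ {1,…,a} of size b with complement I', is injective. -/

import Mathlib

/-!
Statement 1 (Cox–Materov, "Tate Resolutions and Weyman Complexes").

Let `K` be a field of characteristic `0` and `W` a `K`-vector space of dimension `N+1`.
For integers `b ≤ a ≤ ℓ`, the comultiplication map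
`Φ : ⋀^a K^ℓ → ⋀^b K^ℓ ⊗ ⋀^{a−b} K^ℓ`,
`v₁ ∧ ⋯ ∧ v_a ↦ ∑_I sgn(I, I') v_I ⊗ v_{I'}` (sum over subsets `I ⊆ {1,…,a}` of size `b`,
with complement `I'`), is injective.

Here `v_I = v_{i₁} ∧ ⋯ ∧ v_{i_b}` for `I = {i₁ < ⋯ < i_b}`, and `sgn(I, I')` is the sign
of the permutation of `{1,…,a}` whose bottom row lists `I` (increasingly) followed by `I'`
(increasingly); this permutation is `shufflePerm I hI` below.
-/

set_option synthInstance.maxHeartbeats 1000000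

noncomputable section
open TensorProduct

/-- The wedge `v 0 ∧ ⋯ ∧ v (n-1)` as an element of the `n`-th exterior power. -/
def wedge (K : Type) [Field K] {M : Type} [AddCommGroup M] [Module K M] {n : ℕ}
    (v : Fin n → M) : ⋀[K]^n M :=
  ⟨ExteriorAlgebra.ιMulti K n v, ExteriorAlgebra.ιMulti_range K n (Set.mem_range_self v)⟩

/-- The shuffle permutation of `Fin a` associated to a `b`-element subset `I`:
it sends the first `b` indices increasingly onto `I` and the remaining `a - b` indices
increasingly onto the complement `Iᶜ`. -/
def shufflePerm {a b : ℕ} (I : Finset (Fin a)) (hI : I.card = b) : Equiv.Perm (Fin a) :=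
  have hba : b ≤ a := by
    simpa [hI, Fintype.card_fin] using Finset.card_le_univ I
  have hIc : Iᶜ.card = a - b := by
    simp [Finset.card_compl, hI]
  (finCongr (Nat.add_sub_cancel' hba).symm).trans <|
    finSumFinEquiv.symm.trans <|
      (Equiv.sumCongr (I.orderIsoOfFin hI).toEquiv ((Iᶜ).orderIsoOfFin hIc).toEquiv).trans <|
        (Equiv.sumCongr (Equiv.refl _)
          (Equiv.subtypeEquivRight (fun _ => Finset.mem_compl))).trans
            (Equiv.sumCompl (· ∈ I))

/-- The sign `sgn(I, I')` of the shuffle permutation determined by `I`. -/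
def shuffleSign {a b : ℕ} (I : Finset (Fin a)) (hI : I.card = b) : ℤ :=
  Equiv.Perm.sign (shufflePerm I hI)

/-- `v_I`, the wedge of the entries of `v` indexed by `I`, in increasing order. -/
def subWedge (K : Type) [Field K] {M : Type} [AddCommGroup M] [Module K M] {a b : ℕ}
    (v : Fin a → M) (I : Finset (Fin a)) (hI : I.card = b) : ⋀[K]^b M :=
  wedge K fun j => v (I.orderIsoOfFin hI j)

theorem wedge_eq_aux (K : Type) [Field K] {M : Type} [AddCommGroup M] [Module K M] {n : ℕ}
    (v : Fin n → M) : wedge K v = exteriorPower.ιMulti K n v := rfl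

theorem mul_cast_aux (K : Type) [Field K] {M : Type} [AddCommGroup M] [Module K M] {a b c : ℕ}
    (h : a = b + c) (u : Fin a → M) :
    ExteriorAlgebra.ιMulti K b (fun i => u ((finCongr h).symm (Fin.castAdd c i))) *
      ExteriorAlgebra.ιMulti K c (fun i => u ((finCongr h).symm (Fin.natAdd b i))) =
      ExteriorAlgebra.ιMulti K a u := by
  subst h
  simp only [ExteriorAlgebra.ιMulti_apply]
  rw [← List.prod_append, ← List.ofFn_fin_append]
  congr 2
  funext i
  refine Fin.addCases (fun j => ?_) (fun j => ?_) i <;> simp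

theorem shuffle_term_aux (K : Type) [Field K] {M : Type} [AddCommGroup M] [Module K M] {a b : ℕ}
    (v : Fin a → M) (I : Finset (Fin a)) (hI : I.card = b) (hIc : Iᶜ.card = a - b) :
    shuffleSign I hI • ((subWedge K v I hI : ExteriorAlgebra K M) * 
      (subWedge K v Iᶜ hIc : ExteriorAlgebra K M)) = ExteriorAlgebra.ιMulti K a v := by
  have hba : b ≤ a := by
    simpa [hI, Fintype.card_fin] using Finset.card_le_univ I
  have key := mul_cast_aux K (Nat.add_sub_cancel' hba).symm (v ∘ shufflePerm I hI)
  have h1 : (subWedge K v I hI : ExteriorAlgebra K M) * 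
      (subWedge K v Iᶜ hIc : ExteriorAlgebra K M) =
      ExteriorAlgebra.ιMulti K a (v ∘ shufflePerm I hI) := by
    rw [← key]
    congr 1
    · simp only [subWedge, wedge]
      congr 1
      funext i
      simp [shufflePerm]
    · simp only [subWedge, wedge]
      congr 1
      funext i
      simp [shufflePerm]
  rw [h1, AlternatingMap.map_perm, shuffleSign, Units.smul_def, smul_smul]
  simp [← Units.val_mul]

/-- For `b ≤ a ≤ ℓ`, any linear map
`Φ : ⋀^a K^ℓ → ⋀^b K^ℓ ⊗ ⋀^{a−b} K^ℓ` satisfying the comultiplication formula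
`Φ(v₁ ∧ ⋯ ∧ v_a) = ∑_{I, #I = b} sgn(I, I') • (v_I ⊗ v_{I'})` is injective.
(The formula determines `Φ` uniquely, so this says: the comultiplication is injective.) -/
theorem comultiplication_injective
    (K : Type) [Field K] [CharZero K] (N : ℕ)
    (W : Type) [AddCommGroup W] [Module K W] [FiniteDimensional K W]
    (hW : Module.finrank K W = N + 1)
    (ℓ a b : ℕ) (hba : b ≤ a) (haℓ : a ≤ ℓ)
    (Φ : (⋀[K]^a (Fin ℓ → K)) →ₗ[K] ((⋀[K]^b (Fin ℓ → K)) ⊗[K] (⋀[K]^(a - b) (Fin ℓ → K))))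
    (hΦ : ∀ v : Fin a → (Fin ℓ → K),
      Φ (wedge K v) =
        ∑ I : Finset (Fin a),
          if hI : I.card = b then
            shuffleSign I hI •
              (subWedge K v I hI ⊗ₜ[K]
                subWedge K v Iᶜ (by simp [Finset.card_compl, hI]))
          else 0) :
    Function.Injective Φ := by
  let m : ((⋀[K]^b (Fin ℓ → K)) ⊗[K] (⋀[K]^(a - b) (Fin ℓ → K))) →ₗ[K]
      ExteriorAlgebra K (Fin ℓ → K) :=
    (LinearMap.mul' K (ExteriorAlgebra K (Fin ℓ → K))).comp
      (TensorProduct.map (Submodule.subtype _) (Submodule.subtype _))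
  have hm : m.comp Φ = (a.choose b : K) • Submodule.subtype _ := by
    apply exteriorPower.linearMap_ext
    ext v : 1
    simp only [LinearMap.compAlternatingMap_apply, LinearMap.comp_apply, ← wedge_eq_aux]
    rw [hΦ, map_sum]
    have : ∀ I : Finset (Fin a), m (if hI : I.card = b then
            shuffleSign I hI •
              (subWedge K v I hI ⊗ₜ[K]
                subWedge K v Iᶜ (by simp [Finset.card_compl, hI]))
          else 0) = if I.card = b then ExteriorAlgebra.ιMulti K a v else 0 := by
      intro I
      split_ifs with hI
      · rw [map_zsmul, ← shuffle_term_aux K v I hI (by simp [Finset.card_compl, hI])]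
        rfl
      · exact map_zero _
    rw [Finset.sum_congr rfl fun I _ => this I, ← Finset.sum_filter, Finset.sum_const,
      ← Finset.powerset_univ, ← Finset.powersetCard_eq_filter, Finset.card_powersetCard,
      Finset.card_univ, Fintype.card_fin, ← Nat.cast_smul_eq_nsmul K]
    rfl
  have hc : (a.choose b : K) ≠ 0 := Nat.cast_ne_zero.mpr (Nat.choose_pos hba).ne'
  have hinj : Function.Injective (m.comp Φ) := by
    rw [hm]
    intro x y hxy
    exact Subtype.ext (smul_right_injective _ hc hxy)
  exact Function.Injective.of_comp (f := m) hinj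

end
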